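/- Let V ∈ C(X×Y) be nonnegative, κ > 0, ν a probability measure on Y, and μ a probability measure on X with Lebesgue density bounded above and bounded away from zero. Then the unique minimizer ρ_* of E(ρ) = ∫ V dρ + κ H(ρ|ν) over Γ(μ,ν) has the Gibbs form: there exist measurable functions Π_* : X → ℝ and Ψ_* : Y → ℝ such that ρ_* has density (x,y) ↦ exp( (Π_*(x) + Ψ_*(y) − V(x,y))/κ ) with respect to 𝓛⊗ν. -/

import Mathlib

open MeasureTheory ProbabilityTheory Filter Set
open scoped ENNReal Topology

noncomputable section

abbrev Euc (n : ℕ) : Type := EuclideanSpace ℝ (Fin n)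

/-- The set of couplings (transport plans) between two measures. -/
def Couplings {α β : Type*} [MeasurableSpace α] [MeasurableSpace β]
    (μ : Measure α) (ν : Measure β) : Set (Measure (α × β)) :=
  {γ | IsProbabilityMeasure γ ∧ γ.map Prod.fst = μ ∧ γ.map Prod.snd = ν}

/-- The integrand `s ↦ s log s − s + 1` of the entropy. -/
def entT (s : ℝ) : ℝ := s * Real.log s - s + 1

open scoped Classical in
/-- Weighted negative entropy of `ρ` relative to the reference measure `π`. -/
noncomputable def entropyH {α : Type*} [MeasurableSpace α] (π ρ : Measure α) : ℝ≥0∞ :=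
  if ρ ≪ π then ∫⁻ p, ENNReal.ofReal (entT ((ρ.rnDeriv π p).toReal)) ∂π else ⊤

/-- The reference measure `𝓛|X ⊗ ν` on `X × Y`. -/
noncomputable def Lref {d d' : ℕ} (X : Set (Euc d)) (ν : Measure (Euc d')) :
    Measure (Euc d × Euc d') :=
  (MeasureTheory.volume.restrict X).prod ν

/-- The entropic optimal transport energy `E(ρ) = ∫ V dρ + κ H(ρ|ν)`. -/
noncomputable def energyE {d d' : ℕ} (X : Set (Euc d)) (ν : Measure (Euc d'))
    (V : Euc d × Euc d' → ℝ) (κ : ℝ) (ρ : Measure (Euc d × Euc d')) : ℝ≥0∞ :=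
  (∫⁻ p, ENNReal.ofReal (V p) ∂ρ) + ENNReal.ofReal κ * entropyH (Lref X ν) ρ

open InformationTheory

lemma klFun_add_le {s δ : ℝ} (hs : 0 < s) (h : 0 ≤ s + δ) :
    klFun (s + δ) ≤ klFun s + δ * Real.log s + δ ^ 2 / s := by
  have key : (s + δ) * Real.log (s + δ) ≤ (s + δ) * Real.log s + δ + δ ^ 2 / s := by
    rcases h.eq_or_lt with h0 | h0
    · have hδ : δ = -s := by linarith
      subst hδ
      have : (-s) ^ 2 / s = s := by field_simp
      rw [this]; simp
    · have h1 := Real.log_le_sub_one_of_pos (div_pos h0 hs)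
      rw [Real.log_div h0.ne' hs.ne'] at h1
      have h2 : (s + δ) * (Real.log (s + δ) - Real.log s) ≤ (s + δ) * ((s + δ) / s - 1) :=
        mul_le_mul_of_nonneg_left h1 h
      have h3 : (s + δ) * ((s + δ) / s - 1) = δ + δ ^ 2 / s := by field_simp; ring
      linarith
  simp only [klFun_apply]
  linarith

lemma klFun_segment_le {s q t : ℝ} (hs : 0 ≤ s) (hq : 0 < q) (ht0 : 0 < t) (ht1 : t < 1) :
    klFun ((1 - t) * s + t * q) ≤
      (1 - t) * klFun s + t * klFun q + t * Real.log t * (if s = 0 then q else 0) := by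
  split_ifs with h
  · subst h
    simp only [klFun_apply, mul_zero, zero_add, zero_mul, Real.log_mul ht0.ne' hq.ne']
    apply le_of_eq
    ring
  · have := convexOn_klFun.2 (mem_Ici.2 hs) (mem_Ici.2 hq.le) (sub_nonneg.2 ht1.le) ht0.le
      (by ring)
    simpa using this

section Gibbs

variable {α β : Type*}

/-- Exchange the second coordinates of two points. -/
def exchangeSnd (z : (α × β) × (α × β)) : (α × β) × (α × β) := ((z.1.1, z.2.2), (z.2.1, z.1.2))

/-- The mixed second difference of `w` over the rectangle spanned by two points. -/
def mixedDiff (w : α × β → ℝ) (z : (α × β) × (α × β)) : ℝ :=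
  w z.1 - w (z.2.1, z.1.2) - w (z.1.1, z.2.2) + w z.2

/-- The pairs of points spanning a rectangle whose four corners lie in `E`. -/
def cornersIn (E : Set (α × β)) : Set ((α × β) × (α × β)) :=
  {z | z.1 ∈ E ∧ z.2 ∈ E ∧ (z.2.1, z.1.2) ∈ E ∧ (z.1.1, z.2.2) ∈ E}

lemma abs_mixedDiff_le {w : α × β → ℝ} {B : ℝ} (hB : ∀ p, |w p| ≤ B)
    (z : (α × β) × (α × β)) : |mixedDiff w z| ≤ 4 * B := by
  have h1 := abs_le.1 (hB z.1)
  have h2 := abs_le.1 (hB z.2)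
  have h3 := abs_le.1 (hB (z.2.1, z.1.2))
  have h4 := abs_le.1 (hB (z.1.1, z.2.2))
  unfold mixedDiff
  rw [abs_le]
  constructor <;> linarith [h1.1, h1.2, h2.1, h2.2, h3.1, h3.2, h4.1, h4.2]

/-- The negative of the mixed difference, restricted to rectangles with corners in `E`. -/
def rectangleTest (E : Set (α × β)) (w : α × β → ℝ) : (α × β) × (α × β) → ℝ :=
  (cornersIn E).indicator fun z => -mixedDiff w z

lemma rectangleTest_exchangeSnd (E : Set (α × β)) (w : α × β → ℝ) (z : (α × β) × (α × β)) :
    rectangleTest E w (exchangeSnd z) = -rectangleTest E w z := by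
  have hiff : exchangeSnd z ∈ cornersIn E ↔ z ∈ cornersIn E := by
    simp only [cornersIn, exchangeSnd, mem_ofPred_eq, Prod.mk.eta]; tauto
  by_cases h : z ∈ cornersIn E
  · rw [rectangleTest, indicator_of_mem (hiff.2 h), indicator_of_mem h]
    simp only [mixedDiff, exchangeSnd, Prod.mk.eta]; ring
  · rw [rectangleTest, indicator_of_notMem (mt hiff.1 h), indicator_of_notMem h, neg_zero]

lemma rectangleTest_swap (E : Set (α × β)) (w : α × β → ℝ) (z : (α × β) × (α × β)) :
    rectangleTest E w z.swap = rectangleTest E w z := by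
  have hiff : z.swap ∈ cornersIn E ↔ z ∈ cornersIn E := by
    simp only [cornersIn, mem_ofPred_eq, Prod.fst_swap, Prod.snd_swap]; tauto
  by_cases h : z ∈ cornersIn E
  · rw [rectangleTest, indicator_of_mem (hiff.2 h), indicator_of_mem h]
    simp only [mixedDiff, Prod.fst_swap, Prod.snd_swap]; ring
  · rw [rectangleTest, indicator_of_notMem (mt hiff.1 h), indicator_of_notMem h]

lemma abs_rectangleTest_le {E : Set (α × β)} {w : α × β → ℝ} {B : ℝ} (hB : ∀ p, |w p| ≤ B)
    (z : (α × β) × (α × β)) : |rectangleTest E w z| ≤ 4 * B := by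
  rw [rectangleTest]
  by_cases h : z ∈ cornersIn E
  · rw [indicator_of_mem h, abs_neg]; exact abs_mixedDiff_le hB z
  · rw [indicator_of_notMem h, abs_zero]; exact (abs_nonneg _).trans (abs_mixedDiff_le hB z)

variable [MeasurableSpace α] [MeasurableSpace β]

/-- Two functions have the same marginals when their integrals over all cylinders agree. -/
def SameMarginals (π : Measure (α × β)) (f g : α × β → ℝ) : Prop :=
  (∀ A, MeasurableSet A → ∫ p in Prod.fst ⁻¹' A, f p ∂π = ∫ p in Prod.fst ⁻¹' A, g p ∂π) ∧
    ∀ B, MeasurableSet B → ∫ p in Prod.snd ⁻¹' B, f p ∂π = ∫ p in Prod.snd ⁻¹' B, g p ∂π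

/-- Nonnegative densities with integrable entropy. -/
structure IsEntropicDensity (π : Measure (α × β)) (r : α × β → ℝ) : Prop where
  measurable : Measurable r
  nonneg : ∀ p, 0 ≤ r p
  integrable : Integrable r π
  integrable_klFun : Integrable (fun p => klFun (r p)) π

/-- The integrand of the entropic transport energy, in terms of densities. -/
def gibbsCost (W : α × β → ℝ) (κ : ℝ) (r : α × β → ℝ) (p : α × β) : ℝ :=
  W p * r p + κ * klFun (r p)

/-- `r` minimizes the entropic transport energy among the densities with its marginals. -/
def IsGibbsMinimizer (π : Measure (α × β)) (W : α × β → ℝ) (κ : ℝ) (r : α × β → ℝ) : Prop :=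
  ∀ r', IsEntropicDensity π r' → SameMarginals π r' r →
    ∫ p, gibbsCost W κ r p ∂π ≤ ∫ p, gibbsCost W κ r' p ∂π

lemma IsEntropicDensity.integrable_gibbsCost {π : Measure (α × β)} {W : α × β → ℝ} {κ M : ℝ}
    {r : α × β → ℝ} (hr : IsEntropicDensity π r) (hW : Measurable W) (hWM : ∀ p, |W p| ≤ M) :
    Integrable (gibbsCost W κ r) π :=
  (hr.integrable.bdd_mul hW.aestronglyMeasurable (.of_forall hWM)).add
    (hr.integrable_klFun.const_mul κ)

lemma SameMarginals.segment {π : Measure (α × β)} {r q : α × β → ℝ} (hr : Integrable r π)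
    (hq : Integrable q π) (h : SameMarginals π q r) (t : ℝ) :
    SameMarginals π (fun p => (1 - t) * r p + t * q p) r := by
  constructor
  · intro A hA
    rw [integral_add (hr.integrableOn.const_mul _) (hq.integrableOn.const_mul _),
      integral_const_mul, integral_const_mul, h.1 A hA]
    ring
  · intro A hA
    rw [integral_add (hr.integrableOn.const_mul _) (hq.integrableOn.const_mul _),
      integral_const_mul, integral_const_mul, h.2 A hA]
    ring

lemma IsEntropicDensity.segment {π : Measure (α × β)} {r q : α × β → ℝ}
    (hr : IsEntropicDensity π r) (hq : IsEntropicDensity π q) {t : ℝ} (ht0 : 0 ≤ t)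
    (ht1 : t ≤ 1) : IsEntropicDensity π (fun p => (1 - t) * r p + t * q p) := by
  have hm : Measurable fun p => (1 - t) * r p + t * q p :=
    (hr.measurable.const_mul _).add (hq.measurable.const_mul _)
  have hnn : ∀ p, 0 ≤ (1 - t) * r p + t * q p := fun p =>
    add_nonneg (mul_nonneg (sub_nonneg.2 ht1) (hr.nonneg p)) (mul_nonneg ht0 (hq.nonneg p))
  refine ⟨hm, hnn, (hr.integrable.const_mul _).add (hq.integrable.const_mul _), ?_⟩
  refine ((hr.integrable_klFun.const_mul (1 - t)).add (hq.integrable_klFun.const_mul t)).mono'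
    (measurable_klFun.comp hm).aestronglyMeasurable (.of_forall fun p => ?_)
  rw [Real.norm_of_nonneg (klFun_nonneg (hnn p))]
  simpa using convexOn_klFun.2 (mem_Ici.2 (hr.nonneg p)) (mem_Ici.2 (hq.nonneg p))
    (sub_nonneg.2 ht1) ht0 (by ring)

/-- A minimizer is positive almost everywhere. -/
lemma IsGibbsMinimizer.ae_pos {π : Measure (α × β)} {W : α × β → ℝ} {κ M : ℝ}
    {r q : α × β → ℝ} (hmin : IsGibbsMinimizer π W κ r) (hr : IsEntropicDensity π r)
    (hW : Measurable W) (hWM : ∀ p, |W p| ≤ M) (hκ : 0 < κ) (hq : IsEntropicDensity π q)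
    (hq0 : ∀ p, 0 < q p) (hqr : SameMarginals π q r) : ∀ᵐ p ∂π, 0 < r p := by
  set z : α × β → ℝ := fun p => if r p = 0 then q p else 0 with hz
  have hzm : Measurable z :=
    Measurable.ite (hr.measurable (measurableSet_singleton 0)) hq.measurable measurable_const
  have hz0 : ∀ p, 0 ≤ z p := fun p => by
    simp only [hz]; split_ifs <;> first | exact (hq0 p).le | exact le_rfl
  have hzi : Integrable z π := hq.integrable.mono' hzm.aestronglyMeasurable
    (.of_forall fun p => by
      rw [Real.norm_of_nonneg (hz0 p)]
      simp only [hz]; split_ifs <;> first | exact (hq0 p).le | exact le_rfl)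
  have hGr := hr.integrable_gibbsCost (κ := κ) hW hWM
  have hGq := hq.integrable_gibbsCost (κ := κ) hW hWM
  have bound : ∀ t : ℝ, 0 < t → t < 1 →
      -Real.log t * (κ * ∫ p, z p ∂π) ≤
        (∫ p, gibbsCost W κ q p ∂π) - ∫ p, gibbsCost W κ r p ∂π := by
    intro t ht0 ht1
    have hseg := hr.segment hq ht0.le ht1.le
    have h1 := hmin _ hseg (hqr.segment hr.integrable hq.integrable t)
    have hi : Integrable
        (fun p => (1 - t) * gibbsCost W κ r p + t * gibbsCost W κ q p) π :=
      (hGr.const_mul (1 - t)).add (hGq.const_mul t)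
    have h2 : ∫ p, gibbsCost W κ (fun p => (1 - t) * r p + t * q p) p ∂π ≤
        ∫ p, ((1 - t) * gibbsCost W κ r p + t * gibbsCost W κ q p)
          + (κ * (t * Real.log t)) * z p ∂π := by
      refine integral_mono (hseg.integrable_gibbsCost hW hWM)
        (hi.add (hzi.const_mul _)) fun p => ?_
      have := mul_le_mul_of_nonneg_left
        (klFun_segment_le (hr.nonneg p) (hq0 p) ht0 ht1) hκ.le
      simp only [gibbsCost, hz]
      linarith
    rw [integral_add hi (hzi.const_mul _),
      integral_add (hGr.const_mul (1 - t)) (hGq.const_mul t)] at h2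
    simp only [integral_const_mul] at h2
    have h3 := h1.trans h2
    refine le_of_mul_le_mul_left ?_ ht0
    linarith
  have hzint : ∫ p, z p ∂π = 0 := by
    by_contra hne
    have hpos : 0 < κ * ∫ p, z p ∂π :=
      mul_pos hκ (lt_of_le_of_ne (integral_nonneg hz0) (Ne.symm hne))
    have hlim : Tendsto (fun t : ℝ => -Real.log t * (κ * ∫ p, z p ∂π)) (𝓝[>] 0) atTop :=
      (tendsto_neg_atBot_atTop.comp Real.tendsto_log_nhdsGT_zero).atTop_mul_const hpos
    have hev := hlim.eventually_gt_atTop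
      ((∫ p, gibbsCost W κ q p ∂π) - ∫ p, gibbsCost W κ r p ∂π)
    obtain ⟨t, h1, h2⟩ := (hev.and (Ioo_mem_nhdsGT (zero_lt_one' ℝ))).exists
    exact (bound t h2.1 h2.2).not_gt h1
  filter_upwards [(integral_eq_zero_iff_of_nonneg hz0 hzi).1 hzint] with p hp
  refine lt_of_le_of_ne (hr.nonneg p) fun h => ?_
  simp only [hz, if_pos h.symm, Pi.zero_apply] at hp
  exact (hq0 p).ne' hp

/-- First-order optimality with respect to bounded perturbations that have vanishing marginals
and live where the density is bounded above and below. -/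
lemma IsGibbsMinimizer.integral_mul_nonneg {π : Measure (α × β)} [IsFiniteMeasure π]
    {W : α × β → ℝ} {κ M : ℝ}
    {r h : α × β → ℝ} (hmin : IsGibbsMinimizer π W κ r) (hr : IsEntropicDensity π r)
    (hW : Measurable W) (hWM : ∀ p, |W p| ≤ M) (hκ : 0 < κ) {ε N K : ℝ} (hε : 0 < ε)
    (hh : Measurable h) (hK : ∀ p, |h p| ≤ K) (hsupp : ∀ p, h p ≠ 0 → ε ≤ r p ∧ r p ≤ N)
    (hmarg : SameMarginals π h 0) :
    0 ≤ ∫ p, h p * (W p + κ * Real.log (r p)) ∂π := by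
  set l : α × β → ℝ := fun p => h p * Real.log (r p) with hl
  have hlm : Measurable l := hh.mul (Real.measurable_log.comp hr.measurable)
  have hhi : Integrable h π := .of_bound hh.aestronglyMeasurable K (.of_forall hK)
  have hli : Integrable l π := by
    refine .of_bound hlm.aestronglyMeasurable (K * (|Real.log ε| + |Real.log N|))
      (.of_forall fun p => ?_)
    have hK0 : 0 ≤ K := (abs_nonneg _).trans (hK p)
    by_cases h0 : h p = 0
    · simp only [hl, h0, zero_mul, norm_zero]; positivity
    · obtain ⟨h1, h2⟩ := hsupp p h0
      simp only [hl, norm_mul, Real.norm_eq_abs]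
      have h3 := Real.log_le_log hε h1
      have h4 := Real.log_le_log (hε.trans_le h1) h2
      refine mul_le_mul (hK p) ?_ (abs_nonneg _) hK0
      rw [abs_le]
      constructor
      · linarith [neg_abs_le (Real.log ε), abs_nonneg (Real.log N)]
      · linarith [le_abs_self (Real.log N), abs_nonneg (Real.log ε)]
  have hIi : Integrable (fun p => h p * (W p + κ * Real.log (r p))) π := by
    have := (hhi.bdd_mul hW.aestronglyMeasurable (.of_forall hWM)).add (hli.const_mul κ)
    refine this.congr (.of_forall fun p => ?_)
    simp only [hl, Pi.add_apply]; ring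
  have hGr := hr.integrable_gibbsCost (κ := κ) hW hWM
  have key : ∀ t : ℝ, 0 < t → t < ε / (|K| + 1) →
      0 ≤ (∫ p, h p * (W p + κ * Real.log (r p)) ∂π)
        + t * (π.real univ * (κ * (K ^ 2 / ε))) := by
    intro t ht0 ht1
    rw [lt_div_iff₀ (by positivity)] at ht1
    have hnn : ∀ p, 0 ≤ r p + t * h p := fun p => by
      by_cases h0 : h p = 0
      · simpa [h0] using hr.nonneg p
      · have h1 := (hsupp p h0).1
        have h2 : t * |h p| ≤ t * (|K| + 1) := by
          gcongr; linarith [hK p, le_abs_self K]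
        have h3 : -(t * |h p|) ≤ t * h p := by
          rw [← mul_neg]; gcongr; exact neg_abs_le _
        linarith
    have hkl : ∀ p, klFun (r p + t * h p) ≤ klFun (r p) + t * l p + t ^ 2 * (K ^ 2 / ε) := by
      intro p
      by_cases h0 : h p = 0
      · simp only [h0, mul_zero, add_zero, hl, zero_mul]
        have : 0 ≤ t ^ 2 * (K ^ 2 / ε) := by positivity
        linarith
      · have h1 := (hsupp p h0).1
        have h2 := klFun_add_le (hε.trans_le h1) (hnn p)
        have h3 : (t * h p) ^ 2 / r p ≤ t ^ 2 * (K ^ 2 / ε) := by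
          rw [mul_pow, mul_div_assoc]
          gcongr ?_ * ?_
          exact div_le_div₀ (sq_nonneg _) (sq_le_sq.2 ((hK p).trans (le_abs_self K))) hε h1
        simp only [hl]
        linarith
    have hm : Measurable fun p => r p + t * h p := hr.measurable.add (hh.const_mul t)
    have hdens : IsEntropicDensity π (fun p => r p + t * h p) := by
      refine ⟨hm, hnn, hr.integrable.add (hhi.const_mul t), ?_⟩
      refine ((hr.integrable_klFun.add (hli.const_mul t)).add
        (integrable_const (t ^ 2 * (K ^ 2 / ε)))).mono'
        (measurable_klFun.comp hm).aestronglyMeasurable (.of_forall fun p => ?_)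
      rw [Real.norm_of_nonneg (klFun_nonneg (hnn p))]
      exact hkl p
    have hsm : SameMarginals π (fun p => r p + t * h p) r := by
      constructor
      · intro A hA
        rw [integral_add hr.integrable.integrableOn (hhi.integrableOn.const_mul t),
          integral_const_mul, hmarg.1 A hA]
        simp
      · intro A hA
        rw [integral_add hr.integrable.integrableOn (hhi.integrableOn.const_mul t),
          integral_const_mul, hmarg.2 A hA]
        simp
    have h1 := hmin _ hdens hsm
    have hi : Integrable
        (fun p => gibbsCost W κ r p + t * (h p * (W p + κ * Real.log (r p)))) π :=
      hGr.add (hIi.const_mul t)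
    have h2 : ∫ p, gibbsCost W κ (fun p => r p + t * h p) p ∂π ≤
        ∫ p, (gibbsCost W κ r p + t * (h p * (W p + κ * Real.log (r p))))
          + κ * (t ^ 2 * (K ^ 2 / ε)) ∂π := by
      refine integral_mono (hdens.integrable_gibbsCost hW hWM)
        (hi.add (integrable_const _)) fun p => ?_
      have := mul_le_mul_of_nonneg_left (hkl p) hκ.le
      simp only [gibbsCost, hl] at this ⊢
      linarith
    rw [integral_add hi (integrable_const _),
      integral_add hGr (hIi.const_mul t), integral_const_mul, integral_const, smul_eq_mul] at h2
    have h3 := h1.trans h2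
    refine le_of_mul_le_mul_left ?_ ht0
    linarith
  have hlim : Tendsto (fun t : ℝ => (∫ p, h p * (W p + κ * Real.log (r p)) ∂π)
      + t * (π.real univ * (κ * (K ^ 2 / ε)))) (𝓝[>] 0)
      (𝓝 (∫ p, h p * (W p + κ * Real.log (r p)) ∂π)) := by
    refine Tendsto.mono_left ?_ nhdsWithin_le_nhds
    exact Continuous.tendsto' (by fun_prop) _ _ (by simp)
  refine ge_of_tendsto hlim ?_
  filter_upwards [Ioo_mem_nhdsGT (show 0 < ε / (|K| + 1) by positivity)] with t ht
  exact key t ht.1 ht.2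

lemma measurePreserving_exchangeSnd (μ : Measure α) (ν : Measure β) [SFinite μ] [SFinite ν] :
    MeasurePreserving (exchangeSnd (α := α) (β := β)) ((μ.prod ν).prod (μ.prod ν))
      ((μ.prod ν).prod (μ.prod ν)) := by
  have a1 := measurePreserving_prodAssoc μ ν (μ.prod ν)
  have a2 := measurePreserving_prodAssoc μ ν ν
  have s := Measure.measurePreserving_swap (μ := ν) (ν := μ.prod ν)
  have s' := Measure.measurePreserving_swap (μ := μ.prod ν) (ν := ν)
  have sν := (MeasurePreserving.id μ).prod (Measure.measurePreserving_swap (μ := ν) (ν := ν))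
  have inner := s'.comp ((a2.symm _).comp (sν.comp (a2.comp s)))
  exact (a1.symm _).comp (((MeasurePreserving.id μ).prod inner).comp a1)

lemma measurableSet_cornersIn {E : Set (α × β)} (hE : MeasurableSet E) :
    MeasurableSet (cornersIn E) := by
  have h3 : Measurable fun z : (α × β) × (α × β) => (z.2.1, z.1.2) := by fun_prop
  have h4 : Measurable fun z : (α × β) × (α × β) => (z.1.1, z.2.2) := by fun_prop
  exact (measurable_fst hE).inter ((measurable_snd hE).inter ((h3 hE).inter (h4 hE)))

lemma measurable_mixedDiff {w : α × β → ℝ} (hw : Measurable w) : Measurable (mixedDiff w) := by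
  unfold mixedDiff
  fun_prop

lemma measurable_rectangleTest {E : Set (α × β)} {w : α × β → ℝ} (hE : MeasurableSet E)
    (hw : Measurable w) : Measurable (rectangleTest E w) :=
  (measurable_mixedDiff hw).neg.indicator (measurableSet_cornersIn hE)

lemma integral_eq_of_measurePreserving {γ : Type*} [MeasurableSpace γ] {π : Measure γ}
    {T : γ → γ} (hT : MeasurePreserving T π π) {F : γ → ℝ} (hF : Measurable F) :
    ∫ z, F (T z) ∂π = ∫ z, F z ∂π := by
  conv_rhs => rw [← hT.map_eq]
  exact (integral_map_of_stronglyMeasurable hT.measurable hF.stronglyMeasurable).symm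

section Product

variable {μ : Measure α} {ν : Measure β} [IsFiniteMeasure μ] [IsFiniteMeasure ν]

lemma integral_mul_rectangleTest {E : Set (α × β)} {w : α × β → ℝ} {B : ℝ}
    (hE : MeasurableSet E) (hw : Measurable w) (hB : ∀ p, |w p| ≤ B) {f : α × β → ℝ} {K : ℝ}
    (hf : Measurable f) (hK : ∀ p, |f p| ≤ K) :
    ∫ p, f p * ∫ q, rectangleTest E w (p, q) ∂μ.prod ν ∂μ.prod ν =
      ∫ z, f z.1 * rectangleTest E w z ∂(μ.prod ν).prod (μ.prod ν) := by
  have hφ := measurable_rectangleTest hE hw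
  have hi : Integrable (rectangleTest E w) ((μ.prod ν).prod (μ.prod ν)) :=
    .of_bound hφ.aestronglyMeasurable (4 * B) (.of_forall (abs_rectangleTest_le hB))
  have hfi : Integrable (fun z => f z.1 * rectangleTest E w z) ((μ.prod ν).prod (μ.prod ν)) :=
    hi.bdd_mul (hf.comp measurable_fst).aestronglyMeasurable (.of_forall fun z => hK z.1)
  rw [integral_prod _ hfi]
  simp only [integral_const_mul]

lemma sameMarginals_integral_rectangleTest {E : Set (α × β)} {w : α × β → ℝ} {B : ℝ}
    (hE : MeasurableSet E) (hw : Measurable w) (hB : ∀ p, |w p| ≤ B) :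
    SameMarginals (μ.prod ν) (fun p => ∫ q, rectangleTest E w (p, q) ∂μ.prod ν) 0 := by
  have hφ := measurable_rectangleTest hE hw
  have key : ∀ {S : Set (α × β)} (hS : MeasurableSet S),
      ∫ p in S, ∫ q, rectangleTest E w (p, q) ∂μ.prod ν ∂μ.prod ν =
        ∫ z, S.indicator (fun _ => (1 : ℝ)) z.1 * rectangleTest E w z
          ∂(μ.prod ν).prod (μ.prod ν) := by
    intro S hS
    rw [← integral_mul_rectangleTest hE hw hB (K := 1)
      ((measurable_const (a := (1 : ℝ))).indicator hS), ← integral_indicator hS]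
    · refine integral_congr_ae (.of_forall fun p => ?_)
      by_cases h : p ∈ S <;> simp [h]
    · intro p
      by_cases h : p ∈ S <;> simp [h]
  have hT := measurePreserving_exchangeSnd μ ν
  have hT' : MeasurePreserving Prod.swap ((μ.prod ν).prod (μ.prod ν))
    ((μ.prod ν).prod (μ.prod ν)) := Measure.measurePreserving_swap
  have hmeas : ∀ {S : Set (α × β)} (_ : MeasurableSet S), Measurable fun z =>
      S.indicator (fun _ => (1 : ℝ)) z.1 * rectangleTest E w z := fun hS =>
    (((measurable_const (a := (1 : ℝ))).indicator hS).comp measurable_fst).mul hφ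
  constructor
  · intro A hA
    have hS : MeasurableSet (Prod.fst ⁻¹' A : Set (α × β)) := measurable_fst hA
    rw [key hS]
    have h := integral_eq_of_measurePreserving hT (hmeas hS)
    simp only [rectangleTest_exchangeSnd, mul_neg, integral_neg] at h
    have h' : ∀ z : (α × β) × (α × β),
        (Prod.fst ⁻¹' A : Set (α × β)).indicator (fun _ => (1 : ℝ)) (exchangeSnd z).1 =
          (Prod.fst ⁻¹' A : Set (α × β)).indicator (fun _ => (1 : ℝ)) z.1 := fun _ => rfl
    simp only [h'] at h
    simp only [Pi.zero_apply, integral_zero]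
    linarith
  · intro A hA
    have hS : MeasurableSet (Prod.snd ⁻¹' A : Set (α × β)) := measurable_snd hA
    rw [key hS]
    have h := integral_eq_of_measurePreserving (hT'.comp hT) (hmeas hS)
    simp only [Function.comp_apply, rectangleTest_swap, rectangleTest_exchangeSnd, mul_neg,
      integral_neg] at h
    have h' : ∀ z : (α × β) × (α × β),
        (Prod.snd ⁻¹' A : Set (α × β)).indicator (fun _ => (1 : ℝ)) (exchangeSnd z).swap.1 =
          (Prod.snd ⁻¹' A : Set (α × β)).indicator (fun _ => (1 : ℝ)) z.1 := fun _ => rfl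
    simp only [h'] at h
    simp only [Pi.zero_apply, integral_zero]
    linarith

lemma mixedDiff_ae_eq_zero {E : Set (α × β)} {w : α × β → ℝ} {B : ℝ}
    (hE : MeasurableSet E) (hw : Measurable w) (hB : ∀ p, |w p| ≤ B)
    (hnn : 0 ≤ ∫ p, w p * ∫ q, rectangleTest E w (p, q) ∂μ.prod ν ∂μ.prod ν) :
    ∀ᵐ z ∂(μ.prod ν).prod (μ.prod ν), z ∈ cornersIn E → mixedDiff w z = 0 := by
  have hφ := measurable_rectangleTest hE hw
  have hT := measurePreserving_exchangeSnd μ ν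
  have hT' : MeasurePreserving Prod.swap ((μ.prod ν).prod (μ.prod ν))
    ((μ.prod ν).prod (μ.prod ν)) := Measure.measurePreserving_swap
  have hi : Integrable (rectangleTest E w) ((μ.prod ν).prod (μ.prod ν)) :=
    .of_bound hφ.aestronglyMeasurable (4 * B) (.of_forall (abs_rectangleTest_le hB))
  rw [integral_mul_rectangleTest hE hw hB hw hB] at hnn
  have hF : Measurable fun z : (α × β) × (α × β) => w z.1 * rectangleTest E w z :=
    (hw.comp measurable_fst).mul hφ
  have e2 := integral_eq_of_measurePreserving hT hF
  have e3 := integral_eq_of_measurePreserving (hT'.comp hT) hF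
  have e4 := integral_eq_of_measurePreserving hT' hF
  simp only [Function.comp_apply, rectangleTest_swap, rectangleTest_exchangeSnd, mul_neg,
    integral_neg, Prod.fst_swap] at e2 e3 e4
  simp only [exchangeSnd] at e2 e3
  have hint : ∀ {g : (α × β) × (α × β) → α × β}, Measurable g →
      Integrable (fun z => w (g z) * rectangleTest E w z) ((μ.prod ν).prod (μ.prod ν)) :=
    fun hg => hi.bdd_mul (hw.comp hg).aestronglyMeasurable (.of_forall fun z => hB _)
  have i1 := hint measurable_fst
  have i2 := hint (g := fun z => (z.1.1, z.2.2)) (by fun_prop)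
  have i3 := hint (g := fun z => (z.2.1, z.1.2)) (by fun_prop)
  have i4 := hint measurable_snd
  have hsum : ∫ z, mixedDiff w z * rectangleTest E w z ∂(μ.prod ν).prod (μ.prod ν) =
      4 * ∫ z, w z.1 * rectangleTest E w z ∂(μ.prod ν).prod (μ.prod ν) := by
    have hexp : (fun z => mixedDiff w z * rectangleTest E w z) =
        (((fun z => w z.1 * rectangleTest E w z)
          - fun z => w (z.2.1, z.1.2) * rectangleTest E w z)
          - fun z => w (z.1.1, z.2.2) * rectangleTest E w z)
          + fun z => w z.2 * rectangleTest E w z := by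
      funext z
      simp only [mixedDiff, Pi.add_apply, Pi.sub_apply]
      ring
    rw [hexp, integral_add' ((i1.sub i3).sub i2) i4, integral_sub' (i1.sub i3) i2,
      integral_sub' i1 i3]
    linarith
  have hsq : ∀ z, mixedDiff w z * rectangleTest E w z = -(rectangleTest E w z) ^ 2 := by
    intro z
    by_cases h : z ∈ cornersIn E
    · rw [rectangleTest, indicator_of_mem h]; ring
    · rw [rectangleTest, indicator_of_notMem h]; ring
  simp only [hsq, integral_neg] at hsum
  have hsqi : Integrable (fun z => rectangleTest E w z ^ 2) ((μ.prod ν).prod (μ.prod ν)) := by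
    have := hi.bdd_mul hφ.aestronglyMeasurable (.of_forall (abs_rectangleTest_le hB))
    simpa only [sq] using this
  have hz : ∫ z, rectangleTest E w z ^ 2 ∂(μ.prod ν).prod (μ.prod ν) = 0 :=
    le_antisymm (by linarith) (integral_nonneg fun z => sq_nonneg _)
  filter_upwards [(integral_eq_zero_iff_of_nonneg (fun z => sq_nonneg _) hsqi).1 hz] with z h hm
  simpa [rectangleTest, hm] using h

/-- A minimizer of the entropic transport energy is a Gibbs density. -/
lemma IsGibbsMinimizer.exists_potentials [NeZero (μ.prod ν)] {W : α × β → ℝ} {κ M : ℝ}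
    {r q : α × β → ℝ} (hmin : IsGibbsMinimizer (μ.prod ν) W κ r)
    (hr : IsEntropicDensity (μ.prod ν) r)
    (hW : Measurable W) (hWM : ∀ p, |W p| ≤ M) (hκ : 0 < κ)
    (hq : IsEntropicDensity (μ.prod ν) q)
    (hq0 : ∀ p, 0 < q p) (hqr : SameMarginals (μ.prod ν) q r) :
    ∃ a : α → ℝ, ∃ b : β → ℝ, Measurable a ∧ Measurable b ∧
      ∀ᵐ p ∂μ.prod ν, r p = Real.exp ((a p.1 + b p.2 - W p) / κ) := by
  have hpos := hmin.ae_pos hr hW hWM hκ hq hq0 hqr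
  set w : α × β → ℝ := fun p => W p + κ * Real.log (r p) with hwdef
  have hw : Measurable w := hW.add ((Real.measurable_log.comp hr.measurable).const_mul κ)
  set E : ℕ → Set (α × β) := fun n => {p | ((n : ℝ) + 1)⁻¹ ≤ r p ∧ r p ≤ n + 1} with hEdef
  have hE : ∀ n, MeasurableSet (E n) := fun n =>
    (measurableSet_le measurable_const hr.measurable).inter
      (measurableSet_le hr.measurable measurable_const)
  have level : ∀ n, ∀ᵐ z ∂(μ.prod ν).prod (μ.prod ν), z ∈ cornersIn (E n) →
      mixedDiff w z = 0 := by
    intro n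
    have hn : (0 : ℝ) < n + 1 := by positivity
    set w' : α × β → ℝ := (E n).indicator w with hw'def
    have hw' : Measurable w' := hw.indicator (hE n)
    set B : ℝ := |M| + κ * Real.log (n + 1) with hBdef
    have hlog : 0 ≤ Real.log ((n : ℝ) + 1) := Real.log_nonneg (by simp)
    have hB : ∀ p, |w' p| ≤ B := by
      intro p
      by_cases hp : p ∈ E n
      · rw [hw'def, indicator_of_mem hp]
        have h1 := Real.log_le_log (inv_pos.2 hn) hp.1
        rw [Real.log_inv] at h1
        have h2 := Real.log_le_log ((inv_pos.2 hn).trans_le hp.1) hp.2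
        have h3 := abs_le.2 ⟨h1, h2⟩
        refine (abs_add_le _ _).trans (add_le_add ((hWM p).trans (le_abs_self M)) ?_)
        rw [abs_mul, abs_of_pos hκ]
        gcongr
      · rw [hw'def, indicator_of_notMem hp, abs_zero]
        positivity
    set h : α × β → ℝ := fun p => ∫ q, rectangleTest (E n) w' (p, q) ∂μ.prod ν with hhdef
    have hφ := measurable_rectangleTest (hE n) hw'
    have hh : Measurable h :=
      (StronglyMeasurable.integral_prod_right'
        (hφ.stronglyMeasurable : StronglyMeasurable (rectangleTest (E n) w'))).measurable
    have hh0 : ∀ p, p ∉ E n → h p = 0 := by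
      intro p hp
      have : ∀ q, rectangleTest (E n) w' (p, q) = 0 := fun q =>
        indicator_of_notMem (fun hz => hp hz.1) _
      simp [hhdef, this]
    have hfoc := hmin.integral_mul_nonneg hr hW hWM hκ (inv_pos.2 hn) hh
      (K := 4 * B * (μ.prod ν).real univ)
      (fun p => norm_integral_le_of_norm_le_const (f := fun q => rectangleTest (E n) w' (p, q))
        (.of_forall fun q => abs_rectangleTest_le hB (p, q)))
      (fun p hp => by
        by_contra hc
        exact hp (hh0 p hc))
      (sameMarginals_integral_rectangleTest (hE n) hw' hB)
    have heq : ∀ p, h p * (W p + κ * Real.log (r p)) = w' p * h p := by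
      intro p
      by_cases hp : p ∈ E n
      · rw [hw'def, indicator_of_mem hp, mul_comm]
      · rw [hh0 p hp]; simp
    simp only [heq] at hfoc
    filter_upwards [mixedDiff_ae_eq_zero (hE n) hw' hB hfoc] with z hz hzE
    have := hz hzE
    obtain ⟨h1, h2, h3, h4⟩ := hzE
    simpa only [mixedDiff, hw'def, indicator_of_mem h1, indicator_of_mem h2,
      indicator_of_mem h3, indicator_of_mem h4] using this
  have hT := measurePreserving_exchangeSnd μ ν
  have p1 : ∀ᵐ z ∂(μ.prod ν).prod (μ.prod ν), 0 < r z.1 :=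
    Measure.quasiMeasurePreserving_fst.ae hpos
  have p2 : ∀ᵐ z ∂(μ.prod ν).prod (μ.prod ν), 0 < r z.2 :=
    Measure.quasiMeasurePreserving_snd.ae hpos
  have p3 := hT.quasiMeasurePreserving.ae p1
  have p4 := hT.quasiMeasurePreserving.ae p2
  have hdiff : ∀ᵐ z ∂(μ.prod ν).prod (μ.prod ν), mixedDiff w z = 0 := by
    filter_upwards [ae_all_iff.2 level, p1, p2, p3, p4] with z hz h1 h2 h3 h4
    simp only [exchangeSnd] at h3 h4
    have ev : ∀ p, 0 < r p → ∀ᶠ n : ℕ in atTop, p ∈ E n := by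
      intro p hp
      have t1 : Tendsto (fun n : ℕ => (n : ℝ) + 1) atTop atTop :=
        tendsto_natCast_atTop_atTop.atTop_add tendsto_const_nhds
      filter_upwards [t1.inv_tendsto_atTop.eventually_lt_const hp,
        t1.eventually_ge_atTop (r p)] with n ha hb
      exact ⟨ha.le, hb⟩
    obtain ⟨n, hn⟩ := ((ev _ h1).and ((ev _ h2).and ((ev _ h4).and (ev _ h3)))).exists
    exact hz n hn
  obtain ⟨p₀, hp₀⟩ := (Measure.ae_ae_of_ae_prod hdiff).exists
  refine ⟨fun x => w (x, p₀.2) - w p₀, fun y => w (p₀.1, y), ?_, ?_, ?_⟩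
  · exact (hw.comp (by fun_prop)).sub_const _
  · exact hw.comp (by fun_prop)
  · filter_upwards [hp₀, hpos] with p h1 h2
    have h3 : w (p.1, p₀.2) - w p₀ + w (p₀.1, p.2) - W p = κ * Real.log (r p) := by
      have hwp : w p = W p + κ * Real.log (r p) := rfl
      simp only [mixedDiff] at h1
      linarith
    simp only [h3]
    rw [mul_div_cancel_left₀ _ hκ.ne', Real.exp_log h2]

end Product

end Gibbs

lemma entT_eq_klFun (s : ℝ) : entT s = klFun s := by
  rw [entT, klFun_apply]; ring

lemma withDensity_ofReal_apply {α : Type*} [MeasurableSpace α] {π : Measure α} {f : α → ℝ}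
    (hf : Integrable f π) (hf0 : ∀ p, 0 ≤ f p) {S : Set α} (hS : MeasurableSet S) :
    π.withDensity (fun p => ENNReal.ofReal (f p)) S = ENNReal.ofReal (∫ p in S, f p ∂π) := by
  rw [withDensity_apply _ hS, ofReal_integral_eq_lintegral_ofReal hf.integrableOn (.of_forall hf0)]

lemma map_withDensity_ofReal_eq_iff {α γ : Type*} [MeasurableSpace α] [MeasurableSpace γ]
    {π : Measure α} {f g : α → ℝ} (hf : Integrable f π) (hf0 : ∀ p, 0 ≤ f p)
    (hg : Integrable g π) (hg0 : ∀ p, 0 ≤ g p) {T : α → γ} (hT : Measurable T) :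
    (π.withDensity fun p => ENNReal.ofReal (f p)).map T =
        (π.withDensity fun p => ENNReal.ofReal (g p)).map T ↔
      ∀ A, MeasurableSet A → ∫ p in T ⁻¹' A, f p ∂π = ∫ p in T ⁻¹' A, g p ∂π := by
  rw [Measure.ext_iff]
  refine forall₂_congr fun A hA => ?_
  rw [Measure.map_apply hT hA, Measure.map_apply hT hA,
    withDensity_ofReal_apply hf hf0 (hT hA), withDensity_ofReal_apply hg hg0 (hT hA),
    ENNReal.ofReal_eq_ofReal_iff (integral_nonneg hf0) (integral_nonneg hg0)]

lemma sameMarginals_iff_map_eq {α β : Type*} [MeasurableSpace α] [MeasurableSpace β]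
    {π : Measure (α × β)} {f g : α × β → ℝ} (hf : Integrable f π) (hf0 : ∀ p, 0 ≤ f p)
    (hg : Integrable g π) (hg0 : ∀ p, 0 ≤ g p) :
    SameMarginals π f g ↔
      (π.withDensity fun p => ENNReal.ofReal (f p)).map Prod.fst =
          (π.withDensity fun p => ENNReal.ofReal (g p)).map Prod.fst ∧
        (π.withDensity fun p => ENNReal.ofReal (f p)).map Prod.snd =
          (π.withDensity fun p => ENNReal.ofReal (g p)).map Prod.snd :=
  and_congr (map_withDensity_ofReal_eq_iff hf hf0 hg hg0 measurable_fst).symm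
    (map_withDensity_ofReal_eq_iff hf hf0 hg hg0 measurable_snd).symm

lemma energyE_withDensity {d d' : ℕ} {X : Set (Euc d)} {ν : Measure (Euc d')}
    [IsFiniteMeasure (Lref X ν)] {V W : Euc d × Euc d' → ℝ} {κ : ℝ} (hκ : 0 ≤ κ)
    (hW : Measurable W) (hW0 : ∀ p, 0 ≤ W p) (hVW : V =ᵐ[Lref X ν] W)
    {f : Euc d × Euc d' → ℝ} (hf : Measurable f) (hf0 : ∀ p, 0 ≤ f p) :
    energyE X ν V κ ((Lref X ν).withDensity fun p => ENNReal.ofReal (f p)) =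
      ∫⁻ p, ENNReal.ofReal (gibbsCost W κ f p) ∂(Lref X ν) := by
  have hac := withDensity_absolutelyContinuous (Lref X ν) fun p => ENNReal.ofReal (f p)
  have hpot : ∫⁻ p, ENNReal.ofReal (V p)
      ∂((Lref X ν).withDensity fun p => ENNReal.ofReal (f p)) =
      ∫⁻ p, ENNReal.ofReal (W p * f p) ∂(Lref X ν) := by
    have hVW' := (hac.ae_eq hVW).fun_comp ENNReal.ofReal
    simp only [Function.comp_def] at hVW'
    rw [lintegral_congr_ae hVW',
      lintegral_withDensity_eq_lintegral_mul _ hf.ennreal_ofReal hW.ennreal_ofReal]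
    refine lintegral_congr fun p => ?_
    rw [Pi.mul_apply, mul_comm, ENNReal.ofReal_mul (hW0 p)]
  have hent : entropyH (Lref X ν) ((Lref X ν).withDensity fun p => ENNReal.ofReal (f p)) =
      ∫⁻ p, ENNReal.ofReal (klFun (f p)) ∂(Lref X ν) := by
    rw [entropyH, if_pos hac]
    refine lintegral_congr_ae ?_
    filter_upwards [Measure.rnDeriv_withDensity (Lref X ν) hf.ennreal_ofReal] with p hp
    rw [hp, ENNReal.toReal_ofReal (hf0 p), entT_eq_klFun]
  have hWf : Measurable fun p => W p * f p := hW.mul hf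
  have hkm : Measurable fun p => klFun (f p) := measurable_klFun.comp hf
  rw [energyE, hpot, hent, ← lintegral_const_mul _ hkm.ennreal_ofReal,
    ← lintegral_add_left hWf.ennreal_ofReal]
  refine lintegral_congr fun p => ?_
  rw [← ENNReal.ofReal_mul hκ, ← ENNReal.ofReal_add (mul_nonneg (hW0 p) (hf0 p))
    (mul_nonneg hκ (klFun_nonneg (hf0 p))), gibbsCost]

/-- A continuous function on a product of compact sets agrees on it with a bounded measurable
nonnegative function. -/
lemma exists_bounded_measurable_eqOn {E : Type*} [TopologicalSpace E] [T2Space E]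
    [MeasurableSpace E] [BorelSpace E] {S : Set E} (hS : IsCompact S) {V : E → ℝ}
    (hV : ContinuousOn V S) (hV0 : ∀ p, 0 ≤ V p) :
    ∃ W : E → ℝ, ∃ M : ℝ, Measurable W ∧ (∀ p, 0 ≤ W p) ∧ (∀ p, |W p| ≤ M) ∧ EqOn V W S := by
  classical
  obtain ⟨M, hM⟩ := hS.exists_bound_of_continuousOn hV
  refine ⟨S.piecewise V 0, max M 0,
    hV.measurable_piecewise continuousOn_const hS.measurableSet, fun p => ?_, fun p => ?_,
    fun p hp => (piecewise_eq_of_mem _ _ _ hp).symm⟩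
  · by_cases hp : p ∈ S <;> simp [hp, hV0]
  · by_cases hp : p ∈ S
    · simpa [hp] using Or.inl (hM p hp)
    · simp [hp]

lemma ae_lref_mem_prod {d d' : ℕ} {X : Set (Euc d)} {Y : Set (Euc d')} (hX : MeasurableSet X)
    {ν : Measure (Euc d')} [SFinite ν] (hνY : ν Yᶜ = 0) : ∀ᵐ p ∂(Lref X ν), p ∈ X ×ˢ Y := by
  have h1 : ∀ᵐ p ∂(Lref X ν), p.1 ∈ X :=
    Measure.quasiMeasurePreserving_fst.ae (ae_restrict_mem hX)
  have h2 : ∀ᵐ p ∂(Lref X ν), p.2 ∈ Y :=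
    Measure.quasiMeasurePreserving_snd.ae (show ∀ᵐ y ∂ν, y ∈ Y from hνY)
  filter_upwards [h1, h2] with p hp1 hp2
  exact ⟨hp1, hp2⟩

/-- the unique minimizer `ρ_*` of `E` over `Γ(μ,ν)` has the Gibbs form:
there exist measurable `Π_* : X → ℝ`, `Ψ_* : Y → ℝ` such that `ρ_*` has density
`exp((Π_*(x) + Ψ_*(y) − V(x,y))/κ)` with respect to `𝓛 ⊗ ν`. -/
theorem stmt6 {d d' : ℕ} (X : Set (Euc d)) (Y : Set (Euc d'))
    (hX : IsCompact X) (hXne : X.Nonempty) (hY : IsCompact Y) (hYne : Y.Nonempty)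
    (V : Euc d × Euc d' → ℝ) (hV : ContinuousOn V (X ×ˢ Y)) (hV0 : ∀ p, 0 ≤ V p)
    (κ : ℝ) (hκ : 0 < κ)
    (ν : Measure (Euc d')) [IsProbabilityMeasure ν] (hνY : ν Yᶜ = 0)
    (m : Euc d → ℝ) (hmMeas : Measurable m)
    (c C : ℝ) (hc : 0 < c) (hmbound : ∀ x ∈ X, c ≤ m x ∧ m x ≤ C)
    (μ : Measure (Euc d)) [IsProbabilityMeasure μ]
    (hμ : μ = (volume.restrict X).withDensity (fun x => ENNReal.ofReal (m x)))
    (ρStar : Measure (Euc d × Euc d'))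
    (hρStar : ρStar ∈ Couplings μ ν)
    (hmin : ∀ σ ∈ Couplings μ ν, energyE X ν V κ ρStar ≤ energyE X ν V κ σ) :
    ∃ PiStar : Euc d → ℝ, ∃ PsiStar : Euc d' → ℝ,
      Measurable PiStar ∧ Measurable PsiStar ∧
        ρStar = (Lref X ν).withDensity
          (fun p => ENNReal.ofReal (Real.exp ((PiStar p.1 + PsiStar p.2 - V p) / κ))) := by
  obtain ⟨W, M, hW, hW0, hWM, hVWon⟩ := exists_bounded_measurable_eqOn (hX.prod hY) hV hV0
  have hmem : ∀ᵐ p ∂(Lref X ν), p ∈ X ×ˢ Y := ae_lref_mem_prod hX.measurableSet hνY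
  have hVW : V =ᵐ[Lref X ν] W := hmem.mono fun p hp => hVWon hp
  have hfinX : IsFiniteMeasure (volume.restrict X) :=
    ⟨by simpa using hX.measure_lt_top⟩
  have hfin : IsFiniteMeasure (Lref X ν) := by unfold Lref; infer_instance
  obtain ⟨x₀, hx₀⟩ := hXne
  have hcC : c ≤ C := (hmbound x₀ hx₀).1.trans (hmbound x₀ hx₀).2
  set q : Euc d × Euc d' → ℝ := fun p => max c (min (m p.1) C) with hqdef
  have hqm : Measurable q := measurable_const.max ((hmMeas.comp measurable_fst).min measurable_const)
  have hqc : ∀ p, c ≤ q p := fun p => le_max_left _ _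
  have hqC : ∀ p, q p ≤ C := fun p => max_le hcC (min_le_right _ _)
  have hq0 : ∀ p, 0 < q p := fun p => hc.trans_le (hqc p)
  have hqd : IsEntropicDensity (Lref X ν) q := by
    refine ⟨hqm, fun p => (hq0 p).le, .of_bound hqm.aestronglyMeasurable C
      (.of_forall fun p => by rw [Real.norm_of_nonneg (hq0 p).le]; exact hqC p), ?_⟩
    obtain ⟨K, hK⟩ := (isCompact_Icc (a := c) (b := C)).exists_bound_of_continuousOn
      continuous_klFun.continuousOn
    exact .of_bound (measurable_klFun.comp hqm).aestronglyMeasurable K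
      (.of_forall fun p => hK _ ⟨hqc p, hqC p⟩)
  have hprod : μ.prod ν = (Lref X ν).withDensity fun p => ENNReal.ofReal (q p) := by
    rw [hμ, prod_withDensity_left hmMeas.ennreal_ofReal]
    refine withDensity_congr_ae ?_
    filter_upwards [hmem] with p hp
    obtain ⟨h1, h2⟩ := hmbound p.1 hp.1
    simp only [hqdef, min_eq_left h2, max_eq_right h1]
  have hprodC : μ.prod ν ∈ Couplings μ ν := ⟨inferInstance, by simp, by simp⟩
  have hfinite : energyE X ν V κ ρStar ≠ ⊤ := by
    refine ((hmin _ hprodC).trans_lt (lt_top_iff_ne_top.2 ?_)).ne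
    rw [hprod, energyE_withDensity hκ.le hW hW0 hVW hqm fun p => (hq0 p).le,
      ← ofReal_integral_eq_lintegral_ofReal (hqd.integrable_gibbsCost hW hWM)
        (.of_forall fun p => add_nonneg (mul_nonneg (hW0 p) (hq0 p).le)
          (mul_nonneg hκ.le (klFun_nonneg (hq0 p).le)))]
    exact ENNReal.ofReal_ne_top
  have hent : entropyH (Lref X ν) ρStar ≠ ⊤ := fun h => by
    apply hfinite
    rw [energyE, h, ENNReal.mul_top (by simpa using hκ), add_top]
  have hac : ρStar ≪ Lref X ν := by
    by_contra h
    exact hent (if_neg h)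
  obtain ⟨hρprob, hρ1, hρ2⟩ := hρStar
  set r : Euc d × Euc d' → ℝ := fun p => (ρStar.rnDeriv (Lref X ν) p).toReal with hrdef
  have hrm : Measurable r := (Measure.measurable_rnDeriv _ _).ennreal_toReal
  have hr0 : ∀ p, 0 ≤ r p := fun p => ENNReal.toReal_nonneg
  have hρ : ρStar = (Lref X ν).withDensity fun p => ENNReal.ofReal (r p) := by
    conv_lhs => rw [← Measure.withDensity_rnDeriv_eq ρStar (Lref X ν) hac]
    refine withDensity_congr_ae ?_
    filter_upwards [Measure.rnDeriv_lt_top ρStar (Lref X ν)] with p hp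
    exact (ENNReal.ofReal_toReal hp.ne).symm
  have hrd : IsEntropicDensity (Lref X ν) r := by
    refine ⟨hrm, hr0, Measure.integrable_toReal_rnDeriv, ?_⟩
    rw [entropyH, if_pos hac] at hent
    simp only [entT_eq_klFun] at hent
    exact (lintegral_ofReal_ne_top_iff_integrable (measurable_klFun.comp hrm).aestronglyMeasurable
      (.of_forall fun p => klFun_nonneg (hr0 p))).1 hent
  have hqr : SameMarginals (Lref X ν) q r := by
    rw [sameMarginals_iff_map_eq hqd.integrable hqd.nonneg hrd.integrable hr0, ← hprod, ← hρ,
      hρ1, hρ2]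
    exact hprodC.2
  have hgm : IsGibbsMinimizer (Lref X ν) W κ r := by
    intro r' hr' hmarg
    rw [sameMarginals_iff_map_eq hr'.integrable hr'.nonneg hrd.integrable hr0, ← hρ,
      hρ1, hρ2] at hmarg
    have hprob : IsProbabilityMeasure
        ((Lref X ν).withDensity fun p => ENNReal.ofReal (r' p)) := by
      constructor
      rw [← preimage_univ (f := Prod.fst), ← Measure.map_apply measurable_fst MeasurableSet.univ,
        hmarg.1, measure_univ]
    have h := hmin _ ⟨hprob, hmarg⟩
    have hnn : ∀ {f : Euc d × Euc d' → ℝ}, (∀ p, 0 ≤ f p) → ∀ p, 0 ≤ gibbsCost W κ f p :=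
      fun hf p => add_nonneg (mul_nonneg (hW0 p) (hf p))
        (mul_nonneg hκ.le (klFun_nonneg (hf p)))
    rw [hρ, energyE_withDensity hκ.le hW hW0 hVW hrm hr0,
      energyE_withDensity hκ.le hW hW0 hVW hr'.measurable hr'.nonneg,
      ← ofReal_integral_eq_lintegral_ofReal (hrd.integrable_gibbsCost hW hWM)
        (.of_forall (hnn hr0)),
      ← ofReal_integral_eq_lintegral_ofReal (hr'.integrable_gibbsCost hW hWM)
        (.of_forall (hnn hr'.nonneg)),
      ENNReal.ofReal_le_ofReal_iff (integral_nonneg (hnn hr'.nonneg))] at h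
    exact h
  have hne : NeZero (Lref X ν) := ⟨fun h0 => by
    rw [h0, Measure.absolutelyContinuous_zero_iff] at hac
    exact IsProbabilityMeasure.ne_zero ρStar hac⟩
  obtain ⟨a, b, ha, hb, hab⟩ :
      ∃ a : Euc d → ℝ, ∃ b : Euc d' → ℝ, Measurable a ∧ Measurable b ∧
        ∀ᵐ p ∂(Lref X ν), r p = Real.exp ((a p.1 + b p.2 - W p) / κ) := by
    unfold Lref at *
    exact hgm.exists_potentials hrd hW hWM hκ hqd hq0 hqr
  refine ⟨a, b, ha, hb, ?_⟩
  rw [hρ]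
  refine withDensity_congr_ae ?_
  filter_upwards [hab, hVW] with p hp hVp
  rw [hp, hVp]


end
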